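/- Let λ be a nonzero real number and let r ≥ 1 and k ≥ 1 be integers. Then H^{(r)}_{k,λ} = (1/λ)·( binom(r+k−1, k) − binom(r+k−λ−1, k) ); equivalently, H^{(r)}_{k,λ} = (⟨r⟩_k − ⟨r−λ⟩_k)/(λ·k!). -/

import Mathlib

open Finset

/-- The degenerate falling factorial `(x)_{n,λ} = x(x-λ)⋯(x-(n-1)λ)`. -/
noncomputable def degFall (lam x : ℝ) (n : ℕ) : ℝ := ∏ i ∈ Finset.range n, (x - (i : ℝ) * lam)

/-- The ordinary falling factorial `(x)_n = x(x-1)⋯(x-n+1)`. -/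
noncomputable def fall (x : ℝ) (n : ℕ) : ℝ := ∏ i ∈ Finset.range n, (x - (i : ℝ))

/-- The rising factorial `⟨a⟩_k = a(a+1)⋯(a+k-1)`. -/
noncomputable def rising (a : ℝ) (k : ℕ) : ℝ := ∏ i ∈ Finset.range k, (a + (i : ℝ))

/-- The generalized binomial coefficient `binom(a,k) = a(a-1)⋯(a-k+1)/k!`. -/
noncomputable def rchoose (a : ℝ) (k : ℕ) : ℝ :=
  (∏ i ∈ Finset.range k, (a - (i : ℝ))) / (k.factorial : ℝ)

/-- The degenerate harmonic numbers `H_{n,λ} = Σ_{k=1}^n (1/k)·binom(k-1-λ, k-1)`. -/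
noncomputable def degH (lam : ℝ) (n : ℕ) : ℝ :=
  ∑ k ∈ Finset.Icc 1 n, (1 / (k : ℝ)) * rchoose ((k : ℝ) - 1 - lam) (k - 1)

/-- The degenerate hyperharmonic numbers `H^{(r)}_{n,λ}`. -/
noncomputable def degHyperH (lam : ℝ) : ℕ → ℕ → ℝ
  | 0, _ => 0
  | 1, n => degH lam n
  | r + 2, n => ∑ k ∈ Finset.Icc 1 n, degHyperH lam (r + 1) k

/-- The degenerate harmonic-Fubini polynomial built from degenerate Stirling numbers `S2`. -/
noncomputable def HFpoly (lam : ℝ) (S2 : ℕ → ℕ → ℝ) (n : ℕ) (x : ℝ) : ℝ :=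
  ∑ k ∈ Finset.Icc 1 n, S2 n k * degH lam k * (k.factorial : ℝ) * x ^ k

/-- The degenerate Fubini polynomial of order `1-λ` built from degenerate Stirling numbers `S2`. -/
noncomputable def Fpoly (lam : ℝ) (S2 : ℕ → ℕ → ℝ) (n : ℕ) (x : ℝ) : ℝ :=
  ∑ k ∈ Finset.range (n + 1), rising (1 - lam) k * S2 n k * x ^ k

/-- The degenerate hyperharmonic-Fubini polynomial built from degenerate Stirling numbers `S2`. -/
noncomputable def HFpolyR (lam : ℝ) (S2 : ℕ → ℕ → ℝ) (r n : ℕ) (y : ℝ) : ℝ :=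
  ∑ k ∈ Finset.Icc 1 n, S2 n k * degHyperH lam r k * (k.factorial : ℝ) * y ^ k

/-- The degenerate falling factorial power of the operator `θ = x·d/dx`:
`(θ)_{k,λ} = (θ - (k-1)λ) ∘ ⋯ ∘ (θ - λ) ∘ θ`. -/
noncomputable def thetaFall (lam : ℝ) : ℕ → (ℝ → ℝ) → ℝ → ℝ
  | 0, g => g
  | k + 1, g => fun x => x * deriv (thetaFall lam k g) x - (k : ℝ) * lam * thetaFall lam k g x

theorem rising_succ (a : ℝ) (k : ℕ) : rising a (k + 1) = rising a k * (a + k) :=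
  Finset.prod_range_succ _ _

theorem rising_succ' (a : ℝ) (k : ℕ) : rising a (k + 1) = a * rising (a + 1) k := by
  rw [rising, Finset.prod_range_succ', mul_comm, rising]
  congr 1
  · simp
  · exact Finset.prod_congr rfl fun i _ => by push_cast; ring

theorem rising_one (k : ℕ) : rising 1 k = (k.factorial : ℝ) := by
  induction k with
  | zero => simp [rising]
  | succ k ih => rw [rising_succ, ih, Nat.factorial_succ]; push_cast; ring

theorem rchoose_eq_rising_div (a : ℝ) (k : ℕ) :
    rchoose (a + k - 1) k = rising a k / (k.factorial : ℝ) := by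
  rw [rchoose, rising, ← Finset.prod_range_reflect]
  congr 1
  refine Finset.prod_congr rfl fun i hi => ?_
  have h : i + 1 ≤ k := Finset.mem_range.mp hi
  rw [Nat.sub_sub, add_comm 1 i, Nat.cast_sub h]
  push_cast
  ring

/-- Pascal's rule for the normalized rising factorials. -/
theorem rising_div_factorial_succ (a : ℝ) (k : ℕ) :
    rising (a + 1) (k + 1) / ((k + 1).factorial : ℝ)
      = rising (a + 1) k / (k.factorial : ℝ) + rising a (k + 1) / ((k + 1).factorial : ℝ) := by
  have hk : (k.factorial : ℝ) ≠ 0 := by positivity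
  rw [rising_succ, rising_succ', Nat.factorial_succ]
  push_cast
  field_simp
  ring

theorem degH_eq {lam : ℝ} (hlam : lam ≠ 0) (n : ℕ) :
    degH lam n = (1 - rising (1 - lam) n / (n.factorial : ℝ)) / lam := by
  induction n with
  | zero => simp [degH, rising]
  | succ n ih =>
    have hn : (n.factorial : ℝ) ≠ 0 := by positivity
    have hc : rchoose (((n + 1 : ℕ) : ℝ) - 1 - lam) n
        = rising (1 - lam) n / (n.factorial : ℝ) := by
      rw [← rchoose_eq_rising_div]
      congr 1
      push_cast
      ring
    rw [degH, Finset.sum_Icc_succ_top (by omega), ← degH, ih, Nat.add_sub_cancel, hc,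
      rising_succ, Nat.factorial_succ]
    push_cast
    field_simp
    ring

theorem degHyperH_succ_eq {lam : ℝ} (hlam : lam ≠ 0) (r n : ℕ) :
    degHyperH lam (r + 1) n
      = (rising ((r : ℝ) + 1) n / (n.factorial : ℝ)
          - rising ((r : ℝ) + 1 - lam) n / (n.factorial : ℝ)) / lam := by
  induction r generalizing n with
  | zero =>
    have hn : (n.factorial : ℝ) ≠ 0 := by positivity
    simp [degHyperH, degH_eq hlam, rising_one, hn]
  | succ r ihr =>
    induction n with
    | zero => simp [degHyperH, rising]
    | succ n ihn =>
      have h := rising_div_factorial_succ ((r : ℝ) + 1 - lam) n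
      rw [show (r : ℝ) + 1 - lam + 1 = ((r + 1 : ℕ) : ℝ) + 1 - lam by push_cast; ring] at h
      have h' := rising_div_factorial_succ ((r : ℝ) + 1) n
      rw [show (r : ℝ) + 1 + 1 = ((r + 1 : ℕ) : ℝ) + 1 by push_cast; ring] at h'
      rw [degHyperH] at ihn ⊢
      rw [Finset.sum_Icc_succ_top (by omega), ihn, ihr, h, h']
      ring

theorem stmt12 (lam : ℝ) (hlam : lam ≠ 0) (r k : ℕ) (hr : 1 ≤ r) (hk : 1 ≤ k) :
    degHyperH lam r k
      = (1 / lam) * (rchoose ((r + k - 1 : ℕ) : ℝ) k - rchoose ((r : ℝ) + (k : ℝ) - lam - 1) k) ∧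
    degHyperH lam r k
      = (rising (r : ℝ) k - rising ((r : ℝ) - lam) k) / (lam * (k.factorial : ℝ)) := by
  have hH : degHyperH lam r k
      = (rising (r : ℝ) k / (k.factorial : ℝ)
          - rising ((r : ℝ) - lam) k / (k.factorial : ℝ)) / lam := by
    obtain ⟨r, rfl⟩ := Nat.exists_eq_add_of_le' hr
    simpa using degHyperH_succ_eq hlam r k
  constructor
  · rw [hH, Nat.cast_sub (by omega), Nat.cast_add, Nat.cast_one, rchoose_eq_rising_div,
      show (r : ℝ) + k - lam - 1 = r - lam + k - 1 by ring, rchoose_eq_rising_div]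
    ring
  · rw [hH, ← sub_div, div_div, mul_comm lam]
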